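/- arXiv:2106.10934 — 2 statements merged into one kernel-verified Lean document; each statement's English description precedes it below -/
import Mathlib

section
/- Let A be an n×n right-stochastic real matrix, let τ > 0, and set B = I − τ(A − I). Then every entry of the inverse matrix B⁻¹ is nonnegative. -/
/-- A real square matrix is *right stochastic* if all its entries are nonnegative
and each of its rows sums to 1. -/
def Matrix.IsRightStochastic {n : ℕ} (A : Matrix (Fin n) (Fin n) ℝ) : Prop :=
  (∀ i j, 0 ≤ A i j) ∧ (∀ i, ∑ j, A i j = 1)

open Matrix in
/-- Minimum principle: the implicit Euler matrix of a right-stochastic matrix reflects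
nonnegativity of vectors. -/
theorem Matrix.IsRightStochastic.nonneg_of_implicit_euler_mulVec_nonneg {n : ℕ}
    {A : Matrix (Fin n) (Fin n) ℝ} (hA : A.IsRightStochastic) {τ : ℝ} (hτ : 0 ≤ τ)
    {v : Fin n → ℝ} (hv : 0 ≤ (1 - τ • (A - 1)) *ᵥ v) : 0 ≤ v := by
  intro k
  have : Nonempty (Fin n) := ⟨k⟩
  obtain ⟨i, hi⟩ := Finite.exists_min v
  have hAv : v i ≤ (A *ᵥ v) i :=
    calc v i = ∑ j, A i j * v i := by rw [← Finset.sum_mul, hA.2, one_mul]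
      _ ≤ ∑ j, A i j * v j :=
        Finset.sum_le_sum fun j _ => mul_le_mul_of_nonneg_left (hi j) (hA.1 i j)
  have hvi : 0 ≤ v i - τ * ((A *ᵥ v) i - v i) := by
    simpa [sub_mulVec, smul_mulVec] using hv i
  have hmul := mul_nonneg hτ (sub_nonneg.2 hAv)
  exact le_trans (show (0 : ℝ) ≤ v i by linarith) (hi k)

/-- Every entry of the inverse of the implicit Euler matrix `B = I − τ(A − I)`
is nonnegative, for a right-stochastic matrix `A` and any step size `τ > 0`. -/
theorem implicit_euler_inverse_entries_nonneg {n : ℕ}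
    (A : Matrix (Fin n) (Fin n) ℝ) (hA : A.IsRightStochastic)
    (τ : ℝ) (hτ : 0 < τ) :
    ∀ i j, 0 ≤ (1 - τ • (A - 1) : Matrix (Fin n) (Fin n) ℝ)⁻¹ i j := by
  intro i j
  by_cases hdet : IsUnit (1 - τ • (A - 1) : Matrix (Fin n) (Fin n) ℝ).det
  · refine hA.nonneg_of_implicit_euler_mulVec_nonneg hτ.le
      (v := fun k => (1 - τ • (A - 1) : Matrix (Fin n) (Fin n) ℝ)⁻¹ k j) (fun k => ?_) i
    change 0 ≤ ((1 - τ • (A - 1)) * (1 - τ • (A - 1))⁻¹ : Matrix (Fin n) (Fin n) ℝ) k j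
    rw [Matrix.mul_nonsing_inv _ hdet, Matrix.one_apply]
    split_ifs <;> simp
  · simp [Matrix.nonsing_inv_apply_not_isUnit _ hdet]
end

section
/- Let A : ℝⁿ → M_n(ℝ) be a continuous matrix-valued function such that A(y) is right stochastic for every y ∈ ℝⁿ (all entries of A(y) are nonnegative and each row sums to 1). Let x : [0,∞) → ℝⁿ be differentiable with x'(t) = (A(x(t)) − I) x(t) for all t ≥ 0. Then for every t ≥ 0 and every index i, min_j x_j(0) ≤ x_i(t) ≤ max_j x_j(0); that is, solutions of the nonlinear graph diffusion equation obey the maximum–minimum principle max_i x_i(0) ≥ x_i(t) ≥ min_i x_i(0) for all t ≥ 0. -/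
open Matrix

open Set Filter Topology

/-- An average with the weights of a row of a right stochastic matrix does not exceed an upper
bound of the averaged values. -/
lemma Matrix.IsRightStochastic.mulVec_le {n : ℕ} {P : Matrix (Fin n) (Fin n) ℝ}
    (hP : P.IsRightStochastic) {v : Fin n → ℝ} {c : ℝ} (hv : ∀ j, v j ≤ c) (i : Fin n) :
    (P *ᵥ v) i ≤ c :=
  calc ∑ j, P i j * v j ≤ ∑ j, P i j * c :=
        Finset.sum_le_sum fun j _ => mul_le_mul_of_nonneg_left (hv j) (hP.1 i j)
    _ = c := by rw [← Finset.sum_mul, hP.2 i, one_mul]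

/-- Right stochastic diffusion with time-dependent weights preserves upper bounds. -/
lemma le_of_hasDerivAt_rightStochastic {n : ℕ} {P : ℝ → Matrix (Fin n) (Fin n) ℝ}
    (hP : ∀ t, (P t).IsRightStochastic) {x : ℝ → Fin n → ℝ}
    (hx : ∀ t : ℝ, 0 ≤ t → HasDerivAt x ((P t - 1) *ᵥ x t) t)
    {M : ℝ} (hM : ∀ j, x 0 j ≤ M) {T : ℝ} (hT : 0 ≤ T) (i : Fin n) : x T i ≤ M := by
  have hxc : ContinuousOn x (Icc 0 T) := fun t ht =>
    (hx t ht.1).continuousAt.continuousWithinAt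
  have barrier (ε : ℝ) (hε : 0 < ε) : ∀ j, x T j ≤ M + ε * T := by
    have hsub : Icc 0 T ⊆ {t | ∀ j, x t j ≤ M + ε * t} := by
      apply IsClosed.Icc_subset_of_forall_mem_nhdsWithin
      · have hset : {t | ∀ j, x t j ≤ M + ε * t} ∩ Icc 0 T =
            {t ∈ Icc 0 T | x t ≤ fun _ : Fin n => M + ε * t} := by
          ext t
          exact and_comm
        rw [hset]
        exact isClosed_Icc.isClosed_le hxc (by fun_prop)
      · simpa using hM
      · rintro t ⟨ht, ht0, -⟩
        refine eventually_all.2 fun j => ?_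
        have hd : HasDerivAt (fun s => x s j - (M + ε * s))
            (((P t - 1) *ᵥ x t) j - ε) t := by
          have hB : HasDerivAt (fun s => M + ε * s) ε t := by
            simpa using ((hasDerivAt_id t).const_mul ε).const_add M
          exact (hasDerivAt_pi.1 (hx t ht0) j).sub hB
        rcases (ht j).lt_or_eq with hlt | heq
        · have hev := hd.continuousAt.eventually_lt continuousAt_const (sub_neg.2 hlt)
          filter_upwards [nhdsWithin_le_nhds hev] with s hs
          exact (sub_neg.1 hs).le
        · have hneg : ((P t - 1) *ᵥ x t) j - ε < 0 := by
            have havg := (hP t).mulVec_le ht j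
            rw [sub_mulVec, one_mulVec, Pi.sub_apply]
            linarith
          have hev := (hd.hasDerivWithinAt (s := Ioi t)).limsup_slope_le' (lt_irrefl t) hneg
          filter_upwards [hev, self_mem_nhdsWithin] with s hs hts
          rw [slope_def_field, div_neg_iff] at hs
          have hts : t < s := hts
          rcases hs with hs | hs <;> linarith
    exact hsub (right_mem_Icc.2 hT)
  have hlim : Tendsto (fun ε : ℝ => M + ε * T) (𝓝[>] 0) (𝓝 M) := by
    have hc : Continuous fun ε : ℝ => M + ε * T := by fun_prop
    simpa using (hc.tendsto 0).mono_left nhdsWithin_le_nhds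
  exact ge_of_tendsto hlim (eventually_mem_nhdsWithin.mono fun ε hε => barrier ε hε i)

/-- Maximum–minimum principle for the nonlinear graph diffusion equation
`x' = (A(x) − I)x`: if `A(y)` is right stochastic for every `y` and depends
continuously on `y`, and `x` is a differentiable solution on `[0,∞)`, then
for every `t ≥ 0` and index `i`, `min_j x_j(0) ≤ x_i(t) ≤ max_j x_j(0)`. -/
theorem grand_min_max_principle {n : ℕ}
    (A : (Fin n → ℝ) → Matrix (Fin n) (Fin n) ℝ)
    (hA_cont : Continuous A)
    (hA_rs : ∀ y : Fin n → ℝ, (A y).IsRightStochastic)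
    (x : ℝ → Fin n → ℝ)
    (hx : ∀ t : ℝ, 0 ≤ t → HasDerivAt x ((A (x t) - 1) *ᵥ (x t)) t) :
    ∀ t : ℝ, 0 ≤ t → ∀ i, (⨅ j, x 0 j) ≤ x t i ∧ x t i ≤ ⨆ j, x 0 j := by
  intro t ht i
  refine ⟨?_, le_of_hasDerivAt_rightStochastic (fun s => hA_rs (x s)) hx
    (le_ciSup (Set.finite_range (x 0)).bddAbove) ht i⟩
  have hneg (s : ℝ) (hs : 0 ≤ s) : HasDerivAt (-x) ((A (x s) - 1) *ᵥ (-x) s) s := by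
    simpa only [Pi.neg_apply, mulVec_neg] using (hx s hs).neg
  exact neg_le_neg_iff.1 (le_of_hasDerivAt_rightStochastic (fun s => hA_rs (x s)) hneg
    (fun j => neg_le_neg (ciInf_le (Set.finite_range (x 0)).bddBelow j)) ht i)
end
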